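/- Every infinite binary sequence that is not the constant sequence 1111… is fixed by at least one of the maps b, c, d: for every infinite binary sequence x with x ≠ 1^∞, there exists g ∈ {b, c, d} such that g·x = x. -/

import Mathlib

/-- The nucleus `{e, a, b, c, d}` of the Grigorchuk self-similar action. -/
inductive GrigGen : Type
  | e | a | b | c | d
  deriving DecidableEq

/-- Output letter of the Grigorchuk transducer: the first letter of `g·(x₀x₁⋯)`
as a function of `g` and `x₀`.  This encodes `a·(0x)=1x`, `a·(1x)=0x`, and that
`b, c, d, e` do not change the first letter. -/
def grigOut : GrigGen → Bool → Bool
  | .e, x => x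
  | .a, x => !x
  | .b, x => x
  | .c, x => x
  | .d, x => x

/-- Restriction (next state) of the Grigorchuk transducer, encoding the mutual
corecursive rules `b·(0x) = 0·(a·x)`, `b·(1x) = 1·(c·x)`, `c·(0x) = 0·(a·x)`,
`c·(1x) = 1·(d·x)`, `d·(0x) = 0x`, `d·(1x) = 1·(b·x)`, and that `a` and `e`
restrict to the identity `e`. -/
def grigNext : GrigGen → Bool → GrigGen
  | .e, _ => .e
  | .a, _ => .e
  | .b, false => .a
  | .b, true => .c
  | .c, false => .a
  | .c, true => .d
  | .d, false => .e
  | .d, true => .b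

/-- The state of the transducer started in state `g` after reading the first
`n` letters of the infinite binary sequence `x`. -/
def grigState (g : GrigGen) (x : ℕ → Bool) : ℕ → GrigGen
  | 0 => g
  | n + 1 => grigNext (grigState g x n) (x n)

/-- The action of a nucleus element `g` on infinite binary sequences
(streams over `{0,1}`), defined by the mutual corecursion above. -/
def grigActStream (g : GrigGen) (x : ℕ → Bool) : ℕ → Bool :=
  fun n => grigOut (grigState g x n) (x n)

/-- The self-similarity rule `g·(x₀x') = (g·x₀)(g|ₓ₀·x')`, at the positions after the first. -/
theorem grigActStream_succ (g : GrigGen) (x : ℕ → Bool) (n : ℕ) :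
    grigActStream g x (n + 1) =
      grigActStream (grigNext g (x 0)) (fun k => x (k + 1)) n := by
  have state_succ : ∀ m, grigState g x (m + 1) =
      grigState (grigNext g (x 0)) (fun k => x (k + 1)) m := by
    intro m
    induction m with
    | zero => rfl
    | succ m ih => rw [grigState, ih, grigState]
  simp only [grigActStream, state_succ]

/-- `g` fixes `x` as soon as it fixes the first letter and its restriction fixes the tail. -/
theorem grigActStream_eq_self {g : GrigGen} {x : ℕ → Bool} (h₀ : grigOut g (x 0) = x 0)
    (h : grigActStream (grigNext g (x 0)) (fun k => x (k + 1)) = fun k => x (k + 1)) :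
    grigActStream g x = x := by
  funext n
  cases n with
  | zero => exact h₀
  | succ n => rw [grigActStream_succ, h]

theorem grigActStream_e (x : ℕ → Bool) : grigActStream .e x = x := by
  funext n
  induction n generalizing x with
  | zero => rfl
  | succ n ih => rw [grigActStream_succ]; exact ih _

/-- A sequence with a `0` at position `n` is fixed by one of `b`, `c`, `d`. -/
theorem exists_grigActStream_eq_self (n : ℕ) (x : ℕ → Bool) (hn : x n = false) :
    ∃ g ∈ ({GrigGen.b, GrigGen.c, GrigGen.d} : Set GrigGen), grigActStream g x = x := by
  induction n generalizing x with
  | zero =>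
    refine ⟨.d, by simp, grigActStream_eq_self rfl ?_⟩
    rw [hn]
    exact grigActStream_e _
  | succ n ih =>
    cases hx₀ : x 0 with
    | false =>
      refine ⟨.d, by simp, grigActStream_eq_self rfl ?_⟩
      rw [hx₀]
      exact grigActStream_e _
    | true =>
      obtain ⟨g, hg, hfix⟩ := ih (fun k => x (k + 1)) hn
      rcases hg with rfl | rfl | rfl
      · exact ⟨.d, by simp, grigActStream_eq_self rfl (by rw [hx₀]; exact hfix)⟩
      · exact ⟨.b, by simp, grigActStream_eq_self rfl (by rw [hx₀]; exact hfix)⟩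
      · exact ⟨.c, by simp, grigActStream_eq_self rfl (by rw [hx₀]; exact hfix)⟩

/-- Every infinite binary sequence other than the constant sequence `1111⋯` is
fixed by at least one of `b`, `c`, `d`. -/
theorem grig_stream_fixed_by_bcd (x : ℕ → Bool) (hx : x ≠ fun _ => true) :
    ∃ g ∈ ({GrigGen.b, GrigGen.c, GrigGen.d} : Set GrigGen),
      grigActStream g x = x := by
  obtain ⟨n, hn⟩ := Function.ne_iff.mp hx
  exact exists_grigActStream_eq_self n x (Bool.eq_false_of_not_eq_true hn)
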